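/- arXiv:math/0507184 — 6 statements merged into one kernel-verified Lean document; each statement's English description precedes it below -/
import Mathlib

section
/- Let R be a commutative ring and let q₂, q₄ ∈ R be such that Δ(q₂,q₄) = q₄²·(16·q₂² − 64·q₄) is a unit of R. Then the quotient R-algebra Γ = R[X]/(X³ + q₂·X² + q₄·X) is an étale R-algebra (formally étale and of finite presentation over R). -/
open Polynomial

/-- The quotient of `R[X]` by a monic separable polynomial is étale over `R`. -/
theorem Polynomial.Separable.etale_quotient {R : Type*} [CommRing R] {f : R[X]}
    (hf : f.Separable) (hm : f.Monic) : Algebra.Etale R (R[X] ⧸ Ideal.span {f}) := by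
  obtain ⟨u, v, h⟩ := hf
  let P : StandardEtalePair R := ⟨f, hm, 1, v, u, 1, by linear_combination h⟩
  have hu : IsUnit (AdjoinRoot.mk P.f P.g) := by simp [P]
  have e : AdjoinRoot f ≃ₐ[R] P.Ring :=
    ((IsLocalization.atUnit (AdjoinRoot f) (Localization.Away (AdjoinRoot.mk P.f P.g)) _
      hu).restrictScalars R).trans P.equivAwayAdjoinRoot.symm
  exact Algebra.Etale.of_equiv (A := P.Ring) e.symm

/-- The cubic `X³ + aX² + bX` is separable if `16` times its discriminant is a unit. -/
theorem Polynomial.separable_cubic_of_isUnit {R : Type*} [CommRing R] {a b : R}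
    (h : IsUnit (b ^ 2 * (16 * a ^ 2 - 64 * b))) :
    (X ^ 3 + C a * X ^ 2 + C b * X : R[X]).Separable := by
  obtain ⟨c, hc⟩ := h.exists_right_inv
  have hC : C b ^ 2 * (16 * C a ^ 2 - 64 * C b) * C c = 1 := by
    simpa only [map_mul, map_sub, map_pow, map_ofNat, map_one] using congrArg (C : R → R[X]) hc
  refine ⟨-16 * C c * ((6 * C a ^ 2 - 18 * C b) * X + (4 * C a ^ 3 - 15 * C a * C b)),
    16 * C c * ((2 * C a ^ 2 - 6 * C b) * X ^ 2 + (2 * C a ^ 3 - 7 * C a * C b) * X +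
      (C a ^ 2 * C b - 4 * C b ^ 2)), ?_⟩
  simp only [derivative_add, derivative_X_pow, derivative_C_mul, derivative_X]
  push_cast
  simp only [map_ofNat]
  linear_combination hC

/-- Let `R` be a commutative ring and `q₂, q₄ ∈ R` be such that
`Δ(q₂,q₄) = q₄² * (16*q₂² - 64*q₄)` is a unit of `R`.  Then the quotient `R`-algebra
`Γ = R[X]/(X³ + q₂·X² + q₄·X)` is an étale `R`-algebra, i.e. it is formally étale
and of finite presentation over `R`. -/
theorem quotient_cubic_is_etale (R : Type*) [CommRing R] (q₂ q₄ : R)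
    (hΔ : IsUnit (q₄ ^ 2 * (16 * q₂ ^ 2 - 64 * q₄))) :
    Algebra.FormallyEtale R
        (R[X] ⧸ Ideal.span {(X ^ 3 + C q₂ * X ^ 2 + C q₄ * X : R[X])}) ∧
    Algebra.FinitePresentation R
        (R[X] ⧸ Ideal.span {(X ^ 3 + C q₂ * X ^ 2 + C q₄ * X : R[X])}) := by
  have hm : (X ^ 3 + C q₂ * X ^ 2 + C q₄ * X : R[X]).Monic := by monicity!
  have := (separable_cubic_of_isUnit hΔ).etale_quotient hm
  exact ⟨inferInstance, inferInstance⟩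
end

section
/- Let R be a commutative ring, q₂, q₄ ∈ R, and let x₀ be an invertible element of R and y₀ ∈ R with y₀² = x₀³ + q₂·x₀² + q₄·x₀. Set u = (x₀² + q₂·x₀ + q₄)/x₀ and v = y₀·(x₀² − q₄)/x₀². Then v² = u³ − 2q₂·u² + (q₂² − 4q₄)·u; that is, (u, v) is an affine point of the curve C_{q₂', q₄'} with q₂' = −2q₂ and q₄' = q₂² − 4q₄. -/
/-- Let `R` be a commutative ring, `q₂, q₄ ∈ R`, let `x₀` be an invertible
element of `R` and `y₀ ∈ R` with `y₀² = x₀³ + q₂x₀² + q₄x₀`.  Set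
`u = (x₀² + q₂x₀ + q₄)/x₀` and `v = y₀(x₀² − q₄)/x₀²`.  Then
`v² = u³ − 2q₂u² + (q₂² − 4q₄)u`; that is, `(u, v)` is an affine point of the curve
`C_{q₂',q₄'}` with `q₂' = −2q₂` and `q₄' = q₂² − 4q₄`. -/
theorem isogeny_point_on_dual_curve (R : Type*) [CommRing R] (q₂ q₄ x₀ y₀ : R)
    [Invertible x₀] (hP : y₀ ^ 2 = x₀ ^ 3 + q₂ * x₀ ^ 2 + q₄ * x₀) :
    (y₀ * (x₀ ^ 2 - q₄) * (⅟x₀) ^ 2) ^ 2 =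
        ((x₀ ^ 2 + q₂ * x₀ + q₄) * ⅟x₀) ^ 3
          - 2 * q₂ * ((x₀ ^ 2 + q₂ * x₀ + q₄) * ⅟x₀) ^ 2
          + (q₂ ^ 2 - 4 * q₄) * ((x₀ ^ 2 + q₂ * x₀ + q₄) * ⅟x₀) ∧
    (⟨0, -2 * q₂, 0, q₂ ^ 2 - 4 * q₄, 0⟩ : WeierstrassCurve R).toAffine.Equation
        ((x₀ ^ 2 + q₂ * x₀ + q₄) * ⅟x₀) (y₀ * (x₀ ^ 2 - q₄) * (⅟x₀) ^ 2) := by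
  have h : x₀ * ⅟x₀ = 1 := mul_invOf_self x₀
  have hu : (x₀ ^ 2 + q₂ * x₀ + q₄) * ⅟x₀ = x₀ + q₂ + q₄ * ⅟x₀ := by
    linear_combination (x₀ + q₂) * h
  have hv : y₀ * (x₀ ^ 2 - q₄) * (⅟x₀) ^ 2 = y₀ * ⅟x₀ * (x₀ - q₄ * ⅟x₀) := by
    linear_combination y₀ * x₀ * ⅟x₀ * h
  have hy : (y₀ * ⅟x₀) ^ 2 = x₀ + q₂ + q₄ * ⅟x₀ := by
    linear_combination (⅟x₀) ^ 2 * hP + (x₀ * (x₀ * ⅟x₀ + 1) + q₂ * (x₀ * ⅟x₀ + 1) + q₄ * ⅟x₀) * h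
  rw [hu, hv, WeierstrassCurve.Affine.equation_iff]
  have key : (y₀ * ⅟x₀ * (x₀ - q₄ * ⅟x₀)) ^ 2 =
      (x₀ + q₂ + q₄ * ⅟x₀) ^ 3 - 2 * q₂ * (x₀ + q₂ + q₄ * ⅟x₀) ^ 2
        + (q₂ ^ 2 - 4 * q₄) * (x₀ + q₂ + q₄ * ⅟x₀) := by
    linear_combination (x₀ - q₄ * ⅟x₀) ^ 2 * hy - 4 * q₄ * (x₀ + q₂ + q₄ * ⅟x₀) * h
  refine ⟨key, ?_⟩
  dsimp only
  linear_combination key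
end

section
/- Let R be a commutative ring, q₂ ∈ R, let x₀ and q₄ be invertible elements of R, and let y₀ ∈ R be arbitrary. Define u(x,y) = (x² + q₂·x + q₄)/x and v(x,y) = y·(x² − q₄)/x². Then u(q₄/x₀, −q₄·y₀/x₀²) = u(x₀, y₀) and v(q₄/x₀, −q₄·y₀/x₀²) = v(x₀, y₀); that is, the isogeny coordinate functions u and v are invariant under the substitution (x, y) ↦ (q₄/x, −q₄·y/x²) given by translation by the 2-torsion point (0,0). -/
/-- Let `R` be a commutative ring, `q₂ ∈ R`, let `x₀` and `q₄` be invertible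
elements of `R`, and let `y₀ ∈ R` be arbitrary.  Define the isogeny coordinate functions
`u(x,y) = (x² + q₂x + q₄)/x` and `v(x,y) = y(x² − q₄)/x²`.  Then
`u(q₄/x₀, −q₄y₀/x₀²) = u(x₀, y₀)` and `v(q₄/x₀, −q₄y₀/x₀²) = v(x₀, y₀)`:
the functions `u` and `v` are invariant under the substitution
`(x, y) ↦ (q₄/x, −q₄y/x²)` given by translation by the 2-torsion point `(0,0)`.
(Here `q₄/x₀ = q₄ * ⅟x₀`, whose inverse is `x₀ * ⅟q₄`.) -/
theorem isogeny_coordinates_invariant (R : Type*) [CommRing R] (q₂ : R) (x₀ q₄ y₀ : R)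
    [Invertible x₀] [Invertible q₄] :
    ((q₄ * ⅟x₀) ^ 2 + q₂ * (q₄ * ⅟x₀) + q₄) * (x₀ * ⅟q₄) =
        (x₀ ^ 2 + q₂ * x₀ + q₄) * ⅟x₀ ∧
    (-(q₄ * y₀) * (⅟x₀) ^ 2) * ((q₄ * ⅟x₀) ^ 2 - q₄) * (x₀ * ⅟q₄) ^ 2 =
        y₀ * (x₀ ^ 2 - q₄) * (⅟x₀) ^ 2 := by
  have hx : x₀ * ⅟x₀ = 1 := mul_invOf_self x₀
  have hq : q₄ * ⅟q₄ = 1 := mul_invOf_self q₄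
  generalize ⅟x₀ = a at *
  generalize ⅟q₄ = b at *
  constructor
  · linear_combination (q₄ * a * (q₄ * b) - x₀) * hx + (q₄ * a + q₂ * (x₀ * a) + x₀) * hq
  · linear_combination
      -y₀ * q₄ * a ^ 2 * (x₀ * a * (q₄ * b) + 1) * (q₄ * b * hx + hq) +
        y₀ * (x₀ * a) ^ 2 * (q₄ * b + 1) * hq
end

section
/- Let F₉ be a field with 9 elements and let W be the Weierstrass curve y² = x³ − x over F₉ (coefficients a₁ = a₂ = a₃ = a₆ = 0, a₄ = −1). The subgroup of the group of admissible changes of Weierstrass variables (u, r, s, t) over F₉ consisting of those σ with σ • W = W has exactly 12 elements. -/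
/-- In characteristic 3, a change of variables fixes `y² = x³ - x` exactly when `s = t = 0`,
`u⁴ = 1` and `r³ = r`. -/
lemma smul_supersingular_curve_eq_self_iff {F : Type*} [Field F] (h3 : (3 : F) = 0)
    (σ : WeierstrassCurve.VariableChange F) :
    σ • (⟨0, 0, 0, -1, 0⟩ : WeierstrassCurve F) = ⟨0, 0, 0, -1, 0⟩ ↔
      σ.u ^ 4 = 1 ∧ σ.r ^ 3 = σ.r ∧ σ.s = 0 ∧ σ.t = 0 := by
  have h2 : (2 : F) ≠ 0 := fun h => one_ne_zero (by linear_combination h3 - h : (1 : F) = 0)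
  rw [WeierstrassCurve.variableChange_def]
  constructor
  · intro h
    simp only [WeierstrassCurve.mk.injEq, mul_eq_zero, Units.ne_zero, pow_eq_zero_iff, ne_eq,
      OfNat.ofNat_ne_zero, not_false_eq_true, false_or, zero_add, h2, h3] at h
    obtain ⟨hs, -, ht, h4, h6⟩ := h
    rw [mul_zero, zero_add] at ht
    have ht : σ.t = 0 := (mul_eq_zero.mp ht).resolve_left h2
    refine ⟨?_, ?_, hs, ht⟩
    · rw [← inv_inj, ← inv_pow, inv_one]
      ext
      rw [Units.val_pow_eq_pow_val, Units.val_one]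
      simp only [hs, ht] at h4
      linear_combination -h4
    · simp only [ht] at h6
      linear_combination h6
  · rintro ⟨hu, hr, hs, ht⟩
    have hu' : (σ.u : F) ^ 4 = 1 := by
      rw [← Units.val_pow_eq_pow_val, hu, Units.val_one]
    ext
    · simp [hs]
    · simp [hs, h3]
    · simp [ht]
    · simp [hs, h3, hu']
    · simp [ht, hr]

/-- In characteristic 3, the automorphisms of `y² = x³ - x` are parametrized by the fourth roots
of unity `u` and the solutions of `r³ = r`. -/
def stabilizerSupersingularCurveEquiv {F : Type*} [Field F] (h3 : (3 : F) = 0) :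
    MulAction.stabilizer (WeierstrassCurve.VariableChange F)
      (⟨0, 0, 0, -1, 0⟩ : WeierstrassCurve F) ≃ {u : Fˣ // u ^ 4 = 1} × {r : F // r ^ 3 = r} where
  toFun σ :=
    have h := (smul_supersingular_curve_eq_self_iff h3 σ.1).mp σ.2
    (⟨σ.1.u, h.1⟩, ⟨σ.1.r, h.2.1⟩)
  invFun p := ⟨⟨p.1, p.2, 0, 0⟩,
    (smul_supersingular_curve_eq_self_iff h3 _).mpr ⟨p.1.2, p.2.2, rfl, rfl⟩⟩
  left_inv σ := by
    have h := (smul_supersingular_curve_eq_self_iff h3 σ.1).mp σ.2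
    ext
    · rfl
    · rfl
    · exact h.2.2.1.symm
    · exact h.2.2.2.symm
  right_inv _ := rfl

/-- Away from characteristic 2, the equation `r³ = r` has exactly three solutions in a field. -/
lemma card_pow_three_eq_self {F : Type*} [Field F] (h2 : (2 : F) ≠ 0) :
    Nat.card {r : F // r ^ 3 = r} = 3 := by
  have hset : {r : F | r ^ 3 = r} = {0, 1, -1} := by
    ext r
    simp only [Set.mem_ofPred_eq, Set.mem_insert_iff, Set.mem_singleton_iff]
    constructor
    · intro h
      have : r * ((r - 1) * (r + 1)) = 0 := by linear_combination h
      simpa [sub_eq_zero, add_eq_zero_iff_eq_neg] using this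
    · rintro (rfl | rfl | rfl) <;> ring
  have hne : (1 : F) ≠ -1 := fun h => h2 (by linear_combination h)
  change Nat.card ({r : F | r ^ 3 = r} : Set F) = 3
  rw [Nat.card_coe_set_eq, hset, Set.ncard_eq_three]
  exact ⟨0, 1, -1, zero_ne_one, by simp, hne, rfl⟩

/-- Let `F₉` be a field with 9 elements and let `W` be the Weierstrass curve
`y² = x³ − x` over `F₉` (coefficients `a₁ = a₂ = a₃ = a₆ = 0`, `a₄ = −1`).  The subgroup of the
group of admissible changes of Weierstrass variables `(u, r, s, t)` over `F₉` consisting of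
those `σ` with `σ • W = W` (i.e. the stabilizer of `W`) has exactly 12 elements. -/
theorem card_aut_supersingular_curve (F : Type*) [Field F] [Fintype F]
    (hF : Fintype.card F = 9) :
    Nat.card (MulAction.stabilizer (WeierstrassCurve.VariableChange F)
      (⟨0, 0, 0, -1, 0⟩ : WeierstrassCurve F)) = 12 := by
  have h3 : (3 : F) = 0 := by
    have h9 : ((9 : ℕ) : F) = 0 := hF ▸ Nat.cast_card_eq_zero F
    exact pow_eq_zero_iff two_ne_zero |>.mp (by push_cast at h9; linear_combination h9)
  have h2 : (2 : F) ≠ 0 := fun h => one_ne_zero (by linear_combination h3 - h : (1 : F) = 0)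
  have hcard : Nat.card Fˣ = 8 := by
    rw [Nat.card_units, Nat.card_eq_fintype_card, hF]
  have hu : Nat.card {u : Fˣ // u ^ 4 = 1} = 4 := by
    have h := IsCyclic.card_powMonoidHom_ker Fˣ 4
    rw [hcard] at h
    exact h
  rw [Nat.card_congr (stabilizerSupersingularCurveEquiv h3), Nat.card_prod, hu,
    card_pow_three_eq_self h2]
end

section
/- Let F₉ be a field with 9 elements, let W be the Weierstrass curve y² = x³ − x over F₉, let ω be a generator of the cyclic group F₉ˣ (an element of multiplicative order 8), and let σ_s and σ_t be the admissible variable changes (u, r, s, t) = (1, 1, 0, 0) and (ω², 0, 0, 0) respectively. Then: σ_s • W = W and σ_t • W = W; σ_s has order 3 and σ_t has order 4 in the variable-change group; σ_t · σ_s · σ_t⁻¹ = σ_s⁻¹; and σ_s and σ_t generate the full stabilizer of W, so that the automorphism group of W over F₉ is isomorphic to the semidirect product C₃ ⋊ C₄ (the dicyclic group of order 12). -/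
open WeierstrassCurve

namespace QuaternionGroup

variable {G : Type*} [Group G] {n : ℕ}

/-- The homomorphism from a dicyclic group determined by elements `x` and `y` satisfying
the defining relations. -/
def lift (x y : G) (hx : x ^ (2 * n) = 1) (hy : y ^ 2 = x ^ n) (hxy : x * y = y * x⁻¹) :
    QuaternionGroup n →* G :=
  let φ : ZMod (2 * n) →+ Additive G :=
    ZMod.lift (2 * n) ⟨zmultiplesHom (Additive G) (Additive.ofMul x), by
      rw [zmultiplesHom_apply, natCast_zsmul, ← ofMul_pow, hx, ofMul_one]⟩
  have φ_int (k : ℤ) : (φ k).toMul = x ^ k := by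
    simp only [φ, ZMod.lift_coe, zmultiplesHom_apply, toMul_zsmul, toMul_ofMul]
  have zpow_mul (k : ℤ) : x ^ k * y = y * x ^ (-k) := by
    have h : SemiconjBy y x⁻¹ x := hxy.symm
    have h' := h.zpow_right k
    rw [inv_zpow'] at h'
    exact h'.eq.symm
  { toFun
      | a i => (φ i).toMul
      | xa i => y * (φ i).toMul
    map_one' := by
      change (φ 0).toMul = 1
      rw [map_zero, toMul_zero]
    map_mul' := by
      rintro (i | i) (j | j) <;>
        obtain ⟨i, rfl⟩ := ZMod.intCast_surjective i <;>
        obtain ⟨j, rfl⟩ := ZMod.intCast_surjective j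
      · simp only [a_mul_a, ← Int.cast_add, φ_int, zpow_add]
      · simp only [a_mul_xa, ← Int.cast_sub, φ_int]
        rw [← mul_assoc, zpow_mul, mul_assoc, ← zpow_add, neg_add_eq_sub]
      · simp only [xa_mul_a, ← Int.cast_add, φ_int, zpow_add, mul_assoc]
      · simp only [xa_mul_xa, ← Int.cast_natCast (R := ZMod (2 * n)) n, ← Int.cast_add,
          ← Int.cast_sub, φ_int]
        rw [mul_assoc, ← mul_assoc (x ^ i), zpow_mul, mul_assoc, ← mul_assoc y, ← sq, hy,
          ← zpow_natCast, ← zpow_add, ← zpow_add]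
        congr 1
        ring }

variable {x y : G} (hx : x ^ (2 * n) = 1) (hy : y ^ 2 = x ^ n) (hxy : x * y = y * x⁻¹)

theorem lift_a_intCast (k : ℤ) : lift x y hx hy hxy (a k) = x ^ k := by
  change Additive.toMul (ZMod.lift (2 * n) _ (k : ZMod (2 * n))) = _
  simp only [ZMod.lift_coe, zmultiplesHom_apply, toMul_zsmul, toMul_ofMul]

theorem lift_xa_intCast (k : ℤ) : lift x y hx hy hxy (xa k) = y * x ^ k :=
  congrArg (y * ·) (lift_a_intCast hx hy hxy k)

theorem lift_injective (hord : orderOf x = 2 * n) (hn : n ≠ 1) :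
    Function.Injective (lift x y hx hy hxy) := by
  rw [injective_iff_map_eq_one]
  rintro (i | i) h <;> obtain ⟨k, rfl⟩ := ZMod.intCast_surjective i
  · rw [lift_a_intCast, ← orderOf_dvd_iff_zpow_eq_one, hord] at h
    rw [(ZMod.intCast_zmod_eq_zero_iff_dvd k (2 * n)).2 h]
    rfl
  · rw [lift_xa_intCast] at h
    have hc : Commute x y := by
      rw [eq_inv_of_mul_eq_one_left h]
      exact ((Commute.refl x).zpow_right k).inv_right
    have h1 : x = x⁻¹ := mul_left_cancel (hc.eq.symm.trans hxy)
    have h2 : orderOf x ∣ 2 := orderOf_dvd_of_pow_eq_one <| by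
      rw [sq]; nth_rewrite 2 [h1]; exact mul_inv_cancel x
    rw [hord] at h2
    exact absurd (Nat.dvd_one.1 (Nat.dvd_of_mul_dvd_mul_left two_pos (by simpa using h2))) hn

theorem range_lift : (lift x y hx hy hxy).range = Subgroup.closure {x, y} := by
  have hxm : x ∈ Subgroup.closure {x, y} := Subgroup.subset_closure (by simp)
  have hym : y ∈ Subgroup.closure {x, y} := Subgroup.subset_closure (by simp)
  apply le_antisymm
  · rintro _ ⟨i | i, rfl⟩ <;> obtain ⟨k, rfl⟩ := ZMod.intCast_surjective i
    · rw [lift_a_intCast]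
      exact zpow_mem hxm k
    · rw [lift_xa_intCast]
      exact mul_mem hym (zpow_mem hxm k)
  · rw [Subgroup.closure_le]
    rintro _ (rfl | rfl)
    · exact ⟨a (1 : ℤ), by rw [lift_a_intCast, zpow_one]⟩
    · exact ⟨xa (0 : ℤ), by rw [lift_xa_intCast, zpow_zero, mul_one]⟩

end QuaternionGroup

namespace WeierstrassCurve.VariableChange

/-- The scalings `(X, Y) ↦ (u²X, u³Y)` as a homomorphism from the units
to the group of variable changes. -/
def scaling (R : Type*) [CommRing R] : Rˣ →* VariableChange R where
  toFun u := ⟨u, 0, 0, 0⟩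
  map_one' := rfl
  map_mul' u v := by simp [mul_def]

theorem scaling_injective (R : Type*) [CommRing R] : Function.Injective (scaling R) :=
  fun _ _ h => congrArg VariableChange.u h

theorem mem_stabilizer_iff {F : Type*} [Field F] (h3 : (3 : F) = 0) (C : VariableChange F) :
    C ∈ MulAction.stabilizer (VariableChange F) (⟨0, 0, 0, -1, 0⟩ : WeierstrassCurve F) ↔
      C.u ^ 4 = 1 ∧ C.r ^ 3 = C.r ∧ C.s = 0 ∧ C.t = 0 := by
  have h2 : (2 : F) ≠ 0 := fun h => one_ne_zero (α := F) (by linear_combination h3 - h)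
  rw [MulAction.mem_stabilizer_iff, variableChange_def, WeierstrassCurve.ext_iff]
  constructor
  · rintro ⟨h₁, -, h₃, h₄, h₆⟩
    have hs : C.s = 0 := by simpa [h2] using h₁
    have ht : C.t = 0 := by simpa [h2] using h₃
    refine ⟨?_, ?_, hs, ht⟩
    · rw [← inv_inj, ← inv_pow, inv_one, Units.ext_iff]
      simpa [hs, ht, h3] using h₄
    · have : C.r * -1 + C.r ^ 3 = 0 := by simpa [hs, ht] using h₆
      linear_combination this
  · rintro ⟨hu, hr, hs, ht⟩
    have hu' : (C.u : F) ^ 4 = 1 := by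
      rw [← Units.val_pow_eq_pow_val, hu, Units.val_one]
    simp [hs, ht, h3, hr, hu']

theorem conj_translation {R : Type*} [CommRing R] (i : Rˣ) (hi : (i : R) ^ 2 = -1) :
    (⟨1, 1, 0, 0⟩ : VariableChange R) * ⟨i, 0, 0, 0⟩ =
      ⟨i, 0, 0, 0⟩ * (⟨1, 1, 0, 0⟩ : VariableChange R)⁻¹ := by
  simp [mul_def, inv_def, hi]

theorem orderOf_translation {R : Type*} [CommRing R] [Nontrivial R] (h3 : (3 : R) = 0) :
    orderOf (⟨1, 1, 0, 0⟩ : VariableChange R) = 3 := by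
  have : Fact (Nat.Prime 3) := ⟨Nat.prime_three⟩
  refine orderOf_eq_prime ?_ fun h => one_ne_zero (congrArg VariableChange.r h)
  have : (1 : R) + 1 + 1 = 0 := by linear_combination h3
  simp [pow_succ, mul_def, one_def, this]

theorem closure_eq_stabilizer {F : Type*} [Field F] (h3 : (3 : F) = 0) (i : Fˣ)
    (hi : ∀ u : Fˣ, u ^ 4 = 1 ↔ u ∈ Subgroup.zpowers i) :
    Subgroup.closure {(⟨1, 1, 0, 0⟩ : VariableChange F), ⟨i, 0, 0, 0⟩} =
      MulAction.stabilizer (VariableChange F) (⟨0, 0, 0, -1, 0⟩ : WeierstrassCurve F) := by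
  apply le_antisymm
  · rw [Subgroup.closure_le]
    rintro _ (rfl | rfl) <;> rw [SetLike.mem_coe, mem_stabilizer_iff h3]
    · simp
    · simp [(hi i).2 (Subgroup.mem_zpowers i)]
  · rintro ⟨u, r, s, t⟩ h
    obtain ⟨hu, hr, rfl, rfl⟩ := (mem_stabilizer_iff h3 _).1 h
    dsimp only at hu hr
    obtain ⟨k, rfl⟩ := (hi u).1 hu
    have hfac : (⟨i ^ k, r, 0, 0⟩ : VariableChange F) =
        (⟨i, 0, 0, 0⟩ : VariableChange F) ^ k * ⟨1, r, 0, 0⟩ := by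
      change _ = scaling F i ^ k * _
      rw [← map_zpow]
      simp [scaling, mul_def]
    have hsm : (⟨1, 1, 0, 0⟩ : VariableChange F) ∈ Subgroup.closure
        {(⟨1, 1, 0, 0⟩ : VariableChange F), ⟨i, 0, 0, 0⟩} := Subgroup.subset_closure (by simp)
    rw [hfac]
    refine mul_mem (zpow_mem (Subgroup.subset_closure (by simp)) k) ?_
    have hr' : r * ((r - 1) * (r + 1)) = 0 := by linear_combination hr
    rcases mul_eq_zero.1 hr' with rfl | hr'
    · exact one_mem _
    rcases mul_eq_zero.1 hr' with hr' | hr'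
    · rwa [sub_eq_zero.1 hr']
    · rw [eq_neg_of_add_eq_zero_left hr']
      convert inv_mem hsm using 1
      simp [inv_def]

theorem nonempty_closure_mulEquiv {F : Type*} [Field F] (h3 : (3 : F) = 0) (i : Fˣ)
    (hi : (i : F) ^ 2 = -1) :
    Nonempty (Subgroup.closure {(⟨1, 1, 0, 0⟩ : VariableChange F), ⟨i, 0, 0, 0⟩} ≃*
      QuaternionGroup 3) := by
  have hii : i * i = -1 := Units.ext (by rw [Units.val_mul, ← sq, hi]; simp)
  set S : VariableChange F := ⟨1, 1, 0, 0⟩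
  set T : VariableChange F := ⟨i, 0, 0, 0⟩
  have hST : S * T = T * S⁻¹ := conj_translation i hi
  have hSord : orderOf S = 3 := orderOf_translation h3
  have hT2 : T ^ 2 = ⟨-1, 0, 0, 0⟩ := by simp [T, sq, mul_def, hii]
  have hT4 : T ^ 2 * T ^ 2 = 1 := by rw [hT2]; simp [mul_def, one_def]
  have hcomm : Commute S (T ^ 2) := by
    rw [hT2]
    simp [S, Commute, SemiconjBy, mul_def]
  have hT2ord : orderOf (T ^ 2) = 2 := by
    refine orderOf_eq_prime (by rw [sq, hT4]) fun h => ?_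
    rw [hT2] at h
    have h' : ((-1 : Fˣ) : F) = (1 : Fˣ) := congrArg (fun C => (C.u : F)) h
    rw [Units.val_neg, Units.val_one] at h'
    exact one_ne_zero (α := F) (by linear_combination h3 + h')
  have hord : orderOf (S * T ^ 2) = 2 * 3 := by
    rw [hcomm.orderOf_mul_eq_mul_orderOf_of_coprime (by rw [hSord, hT2ord]; norm_num),
      hSord, hT2ord]
  have hy : T ^ 2 = (S * T ^ 2) ^ 3 := by
    rw [hcomm.mul_pow, ← hSord, pow_orderOf_eq_one, one_mul, hSord, pow_succ (T ^ 2) 2,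
      sq (T ^ 2), hT4, one_mul]
  have hxy : S * T ^ 2 * T = T * (S * T ^ 2)⁻¹ := by
    rw [mul_inv_rev, inv_eq_of_mul_eq_one_right hT4, hcomm.inv_left.symm.eq, ← mul_assoc, ← hST,
      mul_assoc, mul_assoc, ← pow_succ, ← pow_succ']
  have hclosure : Subgroup.closure {S * T ^ 2, T} = Subgroup.closure {S, T} := by
    have hT (x : VariableChange F) : T ∈ Subgroup.closure {x, T} :=
      Subgroup.subset_closure (by simp)
    have hx (x : VariableChange F) : x ∈ Subgroup.closure {x, T} :=
      Subgroup.subset_closure (by simp)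
    apply le_antisymm <;> rw [Subgroup.closure_le] <;> rintro _ (rfl | rfl)
    · exact mul_mem (hx S) (pow_mem (hT S) 2)
    · exact hT S
    · have := mul_mem (hx (S * T ^ 2)) (pow_mem (hT (S * T ^ 2)) 2)
      rwa [mul_assoc, hT4, mul_one] at this
    · exact hT (S * T ^ 2)
  have hx : (S * T ^ 2) ^ (2 * 3) = 1 := hord ▸ pow_orderOf_eq_one _
  rw [← hclosure, ← QuaternionGroup.range_lift hx hy hxy]
  exact ⟨(MonoidHom.ofInjective
    (QuaternionGroup.lift_injective hx hy hxy hord (by norm_num))).symm⟩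

end WeierstrassCurve.VariableChange

open WeierstrassCurve.VariableChange

/-- Let `F₉` be a field with 9 elements, `W` the Weierstrass curve
`y² = x³ − x` over `F₉`, `ω` a generator of the cyclic group `F₉ˣ` (an element of
multiplicative order 8), and let `σ_s` and `σ_t` be the admissible variable changes
`(u, r, s, t) = (1, 1, 0, 0)` and `(ω², 0, 0, 0)` respectively.  Then `σ_s • W = W` and
`σ_t • W = W`; `σ_s` has order 3 and `σ_t` has order 4 in the variable-change group;
`σ_t * σ_s * σ_t⁻¹ = σ_s⁻¹`; `σ_s` and `σ_t` generate the full stabilizer of `W`; and the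
automorphism group of `W` over `F₉` is isomorphic to the semidirect product `C₃ ⋊ C₄`, the
dicyclic group of order 12 (`QuaternionGroup 3` in Mathlib). -/
theorem aut_supersingular_curve_structure (F : Type*) [Field F] [Fintype F]
    (hF : Fintype.card F = 9) (ω : Fˣ) (hω : orderOf ω = 8) :
    (⟨(ω ^ 2 : Fˣ), 0, 0, 0⟩ : VariableChange F) •
        (⟨0, 0, 0, -1, 0⟩ : WeierstrassCurve F) = ⟨0, 0, 0, -1, 0⟩ ∧
    (⟨1, 1, 0, 0⟩ : VariableChange F) •
        (⟨0, 0, 0, -1, 0⟩ : WeierstrassCurve F) = ⟨0, 0, 0, -1, 0⟩ ∧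
    orderOf (⟨1, 1, 0, 0⟩ : VariableChange F) = 3 ∧
    orderOf (⟨(ω ^ 2 : Fˣ), 0, 0, 0⟩ : VariableChange F) = 4 ∧
    (⟨(ω ^ 2 : Fˣ), 0, 0, 0⟩ : VariableChange F) * ⟨1, 1, 0, 0⟩ *
        (⟨(ω ^ 2 : Fˣ), 0, 0, 0⟩ : VariableChange F)⁻¹ =
      (⟨1, 1, 0, 0⟩ : VariableChange F)⁻¹ ∧
    Subgroup.closure {(⟨1, 1, 0, 0⟩ : VariableChange F), ⟨(ω ^ 2 : Fˣ), 0, 0, 0⟩} =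
      MulAction.stabilizer (VariableChange F) (⟨0, 0, 0, -1, 0⟩ : WeierstrassCurve F) ∧
    Nonempty
      (MulAction.stabilizer (VariableChange F) (⟨0, 0, 0, -1, 0⟩ : WeierstrassCurve F) ≃*
        QuaternionGroup 3) := by
  have h3 : (3 : F) = 0 := by
    have h9 : (9 : F) = 0 := by
      have := Nat.cast_card_eq_zero F
      rw [hF] at this
      exact_mod_cast this
    exact pow_eq_zero_iff two_ne_zero |>.1 (by linear_combination h9 : (3 : F) ^ 2 = 0)
  have hω4 : (ω : F) ^ 4 = -1 := by
    have h8 : (ω : F) ^ 8 = 1 := by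
      rw [← Units.val_pow_eq_pow_val, ← hω, pow_orderOf_eq_one, Units.val_one]
    have h4 : (ω : F) ^ 4 ≠ 1 := by
      rw [← Units.val_pow_eq_pow_val, Ne, Units.val_eq_one]
      exact pow_ne_one_of_lt_orderOf (x := ω) (n := 4) (by norm_num) (by omega)
    have : ((ω : F) ^ 4 - 1) * (ω ^ 4 + 1) = 0 := by linear_combination h8
    exact eq_neg_of_add_eq_zero_left ((mul_eq_zero.1 this).resolve_left (sub_ne_zero.2 h4))
  set i : Fˣ := ω ^ 2 with hi
  have hi2 : (i : F) ^ 2 = -1 := by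
    rw [hi, Units.val_pow_eq_pow_val, ← pow_mul]
    exact hω4
  have hiord : orderOf i = 4 := by rw [hi, orderOf_pow' ω two_ne_zero, hω]; rfl
  have hi4 (u : Fˣ) : u ^ 4 = 1 ↔ u ∈ Subgroup.zpowers i := by
    constructor
    · intro hu
      have hcard : Nat.card (Subgroup.zpowers ω) = Nat.card Fˣ := by
        rw [Nat.card_zpowers, hω, Nat.card_units, Nat.card_eq_fintype_card, hF]
      obtain ⟨k, rfl⟩ : u ∈ Subgroup.zpowers ω := by
        rw [Subgroup.eq_top_of_card_eq _ hcard]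
        exact Subgroup.mem_top u
      dsimp only at hu ⊢
      rw [← zpow_natCast, ← zpow_mul, ← orderOf_dvd_iff_zpow_eq_one, hω] at hu
      obtain ⟨j, rfl⟩ : (2 : ℤ) ∣ k := by omega
      exact ⟨j, by rw [hi, zpow_mul]; rfl⟩
    · rintro ⟨k, rfl⟩
      rw [← zpow_natCast, zpow_comm, zpow_natCast, ← hiord, pow_orderOf_eq_one, one_zpow]
  have hTord : orderOf (⟨i, 0, 0, 0⟩ : VariableChange F) = 4 :=
    (orderOf_injective (scaling F) (scaling_injective F) i).trans hiord
  have hSord := orderOf_translation h3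
  have hconj := conj_translation i hi2
  have hclosure := closure_eq_stabilizer h3 i hi4
  have hmem (C : VariableChange F) (hC : C ∈ ({⟨1, 1, 0, 0⟩, ⟨i, 0, 0, 0⟩} : Set _)) :
      C • (⟨0, 0, 0, -1, 0⟩ : WeierstrassCurve F) = ⟨0, 0, 0, -1, 0⟩ :=
    MulAction.mem_stabilizer_iff.1 (hclosure ▸ Subgroup.subset_closure hC)
  refine ⟨hmem _ (by simp), hmem _ (by simp), hSord, hTord, ?_, hclosure, ?_⟩
  · have hinv : (⟨1, 1, 0, 0⟩ : VariableChange F)⁻¹ = ⟨1, -1, 0, 0⟩ := by simp [inv_def]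
    rw [mul_inv_eq_iff_eq_mul, hinv]
    simp [mul_def, hi2]
  · rw [← hclosure]
    exact nonempty_closure_mulEquiv h3 i hi2
end

section
/- Let p be a prime and let A be an abelian group that is p-adically complete and Hausdorff, i.e. the canonical map A → lim_n A/pⁿA is an isomorphism. For n ≥ 1 let A[ℤ/pⁿ] denote the group of finitely supported functions ℤ/pⁿ → A, with transition maps A[ℤ/p^{n+1}] → A[ℤ/pⁿ] given by summing over the fibers of the projection ℤ/p^{n+1} → ℤ/pⁿ, and let A[[ℤ_p]] = lim_n A[ℤ/pⁿ]. Let T : A[[ℤ_p]] → A[[ℤ_p]] be the limit of the maps f ↦ (g ↦ f(g − 1) − f(g)) (the action of [τ] − 1 for the topological generator τ = 1 of ℤ_p), and let ε : A[[ℤ_p]] → A be the limit of the augmentation maps f ↦ Σ_g f(g). Then the sequence 0 → A[[ℤ_p]] →T A[[ℤ_p]] →ε A → 0 is exact: T is injective, ε is surjective, and the kernel of ε equals the image of T. -/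
namespace CompletedGroupRing

variable (p : ℕ) (A : Type*) [AddCommGroup A]

/-- A family `f n ∈ A[ℤ/pⁿ]` (finitely supported functions `ℤ/pⁿ → A`) is *compatible* if each
`f (n+1)` is carried to `f n` by the transition map `A[ℤ/p^(n+1)] → A[ℤ/pⁿ]` given by summing
over the fibers of the projection `ℤ/p^(n+1) → ℤ/pⁿ` (this fiberwise summation is exactly
`Finsupp.mapDomain` along the projection).  The group `A[[ℤ_p]] = lim_n A[ℤ/pⁿ]` consists of
the compatible families. -/
def IsCompatible (f : ∀ n : ℕ, ZMod (p ^ n) →₀ A) : Prop :=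
  ∀ n : ℕ,
    Finsupp.mapDomain (ZMod.castHom (pow_dvd_pow p n.le_succ) (ZMod (p ^ n))) (f (n + 1)) = f n

/-- The action of `[τ] − 1` (for the topological generator `τ = 1` of `ℤ_p`), applied levelwise:
`(T f) n` is the function `g ↦ f n (g − 1) − f n g`; on finitely supported functions this is
`Finsupp.mapDomain (· + 1) (f n) - f n`. -/
noncomputable def shift (f : ∀ n : ℕ, ZMod (p ^ n) →₀ A) : ∀ n : ℕ, ZMod (p ^ n) →₀ A :=
  fun n => Finsupp.mapDomain (· + 1) (f n) - f n

/-- The augmentation `ε : A[[ℤ_p]] → A`, the limit of the maps `f ↦ Σ_g f(g)`; on a compatible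
family it is computed at level `0`. -/
def aug (f : ∀ n : ℕ, ZMod (p ^ n) →₀ A) : A :=
  (f 0).sum fun _ a => a

section Helpers

variable {M : Type*} [AddCommGroup M]

/-- The operator `[τ] − 1` on finitely supported functions `ℤ/m → M`. -/
noncomputable def levelShift (m : ℕ) : (ZMod m →₀ M) →+ (ZMod m →₀ M) :=
  Finsupp.mapDomain.addMonoidHom (· + 1) - AddMonoidHom.id _

theorem levelShift_apply (m : ℕ) (f : ZMod m →₀ M) :
    levelShift m f = Finsupp.mapDomain (· + 1) f - f := rfl

/-- The element `Σ_{g ∈ ℤ/m} c·[g]`. -/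
noncomputable def normElement (m : ℕ) (c : M) : ZMod m →₀ M :=
  ∑ i ∈ Finset.range m, Finsupp.single (i : ZMod m) c

theorem normElement_apply (m : ℕ) [NeZero m] (c : M) (g : ZMod m) : normElement m c g = c := by
  classical
  rw [normElement, Finsupp.finsetSum_apply, Finset.sum_eq_single g.val]
  · simp
  · intro i hi hne
    refine Finsupp.single_eq_of_ne' fun h => hne ?_
    rw [← h, ZMod.val_cast_of_lt (Finset.mem_range.mp hi)]
  · intro h
    exact absurd (Finset.mem_range.mpr g.val_lt) h

theorem normElement_add (m : ℕ) (c d : M) :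
    normElement m (c + d) = normElement m c + normElement m d := by
  simp [normElement, Finset.sum_add_distrib]

theorem normElement_zero (m : ℕ) : normElement m (0 : M) = 0 := by
  simp [normElement]

theorem normElement_nsmul (m q : ℕ) (c : M) : normElement m (q • c) = q • normElement m c := by
  simp [normElement, Finset.smul_sum]

theorem sum_range_mul_single (m q : ℕ) (c : M) :
    ∑ i ∈ Finset.range (m * q), Finsupp.single (i : ZMod m) c = q • normElement m c := by
  induction q with
  | zero => simp
  | succ q ih =>
    rw [Nat.mul_succ, Finset.sum_range_add, ih, succ_nsmul]
    simp [normElement]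

theorem mapDomain_normElement (m q : ℕ) (h : m ∣ m * q) (c : M) :
    Finsupp.mapDomain (ZMod.castHom h (ZMod m)) (normElement (m * q) c) =
      normElement m (q • c) := by
  rw [normElement_nsmul, ← sum_range_mul_single, normElement, Finsupp.mapDomain_finsetSum]
  simp only [Finsupp.mapDomain_single, map_natCast]

theorem eq_normElement_of_levelShift_eq_zero (m : ℕ) [NeZero m] {f : ZMod m →₀ M}
    (hf : levelShift m f = 0) : f = normElement m (f 0) := by
  have hstep (g : ZMod m) : f (g + 1) = f g := by
    rw [levelShift_apply, sub_eq_zero] at hf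
    conv_lhs => rw [← hf]
    exact Finsupp.mapDomain_apply (add_left_injective 1) f g
  have hnat (k : ℕ) : f (k : ZMod m) = f 0 := by
    induction k with
    | zero => simp
    | succ k ih => rw [Nat.cast_succ, hstep, ih]
  ext g
  rw [normElement_apply, ← hnat g.val, ZMod.natCast_zmod_val]

theorem levelShift_normElement (m : ℕ) [NeZero m] (c : M) :
    levelShift m (normElement m c) = 0 := by
  ext g
  obtain ⟨g, rfl⟩ : ∃ x, x + 1 = g := ⟨g - 1, sub_add_cancel g 1⟩
  have h := Finsupp.mapDomain_apply (add_left_injective (1 : ZMod m)) (normElement m c) g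
  simp only [levelShift_apply, Finsupp.sub_apply, Finsupp.zero_apply]
  rw [h, normElement_apply, normElement_apply, sub_self]

theorem single_natCast_sub_single_zero_mem_range_levelShift (m k : ℕ) (a : M) :
    Finsupp.single (k : ZMod m) a - Finsupp.single 0 a ∈ (levelShift (M := M) m).range := by
  induction k with
  | zero => simp
  | succ k ih =>
    have h : Finsupp.single ((k + 1 : ℕ) : ZMod m) a - Finsupp.single (k : ZMod m) a ∈
        (levelShift (M := M) m).range :=
      ⟨Finsupp.single (k : ZMod m) a, by simp [levelShift_apply, Finsupp.mapDomain_single]⟩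
    simpa using add_mem h ih

theorem sub_single_sum_mem_range_levelShift (m : ℕ) [NeZero m] (f : ZMod m →₀ M) :
    f - Finsupp.single 0 (f.sum fun _ a => a) ∈ (levelShift (M := M) m).range := by
  induction f using Finsupp.induction_linear with
  | zero => simp
  | add f g hf hg =>
    rw [Finsupp.sum_add_index' (fun _ => rfl) (fun _ _ _ => rfl), Finsupp.single_add,
      add_sub_add_comm]
    exact add_mem hf hg
  | single g a =>
    rw [Finsupp.sum_single_index rfl, ← ZMod.natCast_zmod_val g]
    exact single_natCast_sub_single_zero_mem_range_levelShift m _ a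

theorem mapDomain_castHom_levelShift {m l : ℕ} (h : m ∣ l) (f : ZMod l →₀ M) :
    Finsupp.mapDomain (ZMod.castHom h (ZMod m)) (levelShift l f) =
      levelShift m (Finsupp.mapDomain (ZMod.castHom h (ZMod m)) f) := by
  rw [levelShift_apply, levelShift_apply, sub_eq_add_neg, sub_eq_add_neg,
    Finsupp.mapDomain_add, ← Finsupp.mapDomain_comp, ← Finsupp.mapDomain_comp]
  congr 1
  · congr 1
    exact funext fun x => by simp only [Function.comp_apply, map_add, map_one]
  · exact map_neg (Finsupp.mapDomain.addMonoidHom (ZMod.castHom h (ZMod m))) f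

theorem sum_mapDomain {α β : Type*} (u : α → β) (f : α →₀ M) :
    ((Finsupp.mapDomain u f).sum fun _ a => a) = f.sum fun _ a => a :=
  Finsupp.sum_mapDomain_index (fun _ => rfl) (fun _ _ _ => rfl)

theorem sModEq_span_pow_iff (p n : ℕ) (x y : M) :
    x ≡ y [SMOD (Ideal.span {(p : ℤ)} ^ n • ⊤ : Submodule ℤ M)] ↔ ∃ z, x - y = p ^ n • z := by
  rw [SModEq.sub_mem, Ideal.span_singleton_pow, Submodule.ideal_span_singleton_smul,
    Submodule.mem_smul_pointwise_iff_exists]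
  simp only [Submodule.mem_top, true_and]
  refine exists_congr fun z => ?_
  rw [← Nat.cast_pow, natCast_zsmul, eq_comm]

theorem eq_zero_of_forall_eq_pow_nsmul {p : ℕ} [IsHausdorff (Ideal.span {(p : ℤ)}) M] {x : M}
    (h : ∀ k, ∃ z, x = p ^ k • z) : x = 0 := by
  refine IsHausdorff.haus ‹_› x fun k => (sModEq_span_pow_iff p k x 0).2 ?_
  simpa using h k

theorem eq_zero_of_forall_eq_nsmul_succ {p : ℕ} [IsHausdorff (Ideal.span {(p : ℤ)}) M]
    {c : ℕ → M} (h : ∀ n, c n = p • c (n + 1)) (n : ℕ) : c n = 0 := by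
  refine eq_zero_of_forall_eq_pow_nsmul (p := p) fun k => ⟨c (n + k), ?_⟩
  induction k with
  | zero => simp
  | succ k ih => rw [ih, h (n + k), ← mul_nsmul', ← pow_succ, add_assoc]

/-- Vanishing of `lim¹` for the tower of multiplications by `p` on a `p`-adically complete
group. -/
theorem exists_eq_add_nsmul_succ {p : ℕ} [IsAdicComplete (Ideal.span {(p : ℤ)}) M]
    (d : ℕ → M) : ∃ c : ℕ → M, ∀ n, c n = d n + p • c (n + 1) := by
  have hlim (n : ℕ) : ∃ c, ∀ k, ∃ z, ∑ i ∈ Finset.range k, p ^ i • d (n + i) - c = p ^ k • z := by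
    obtain ⟨c, hc⟩ := IsPrecomplete.prec (I := Ideal.span {(p : ℤ)}) inferInstance
      (f := fun k => ∑ i ∈ Finset.range k, p ^ i • d (n + i)) (by
        intro k l hkl
        refine SModEq.symm ((sModEq_span_pow_iff p k _ _).2 ?_)
        obtain ⟨j, rfl⟩ := Nat.exists_eq_add_of_le hkl
        refine ⟨∑ i ∈ Finset.range j, p ^ i • d (n + (k + i)), ?_⟩
        simp only [Finset.sum_range_add, add_sub_cancel_left, Finset.smul_sum, pow_add, mul_nsmul'])
    exact ⟨c, fun k => (sModEq_span_pow_iff p k _ _).1 (hc k)⟩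
  choose c hc using hlim
  refine ⟨c, fun n => sub_eq_zero.1 (eq_zero_of_forall_eq_pow_nsmul (p := p) fun k => ?_)⟩
  obtain ⟨z, hz⟩ := hc n (k + 1)
  obtain ⟨w, hw⟩ := hc (n + 1) k
  refine ⟨p • w - p • z, ?_⟩
  have hsum : ∑ i ∈ Finset.range (k + 1), p ^ i • d (n + i) =
      d n + p • ∑ i ∈ Finset.range k, p ^ i • d (n + 1 + i) := by
    rw [Finset.sum_range_succ', add_comm, Finset.smul_sum]
    simp [pow_succ', mul_nsmul', add_assoc, add_comm 1]
  rw [hsum, sub_eq_iff_eq_add] at hz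
  rw [sub_eq_iff_eq_add] at hw
  have hcn : c n = d n + p • (p ^ k • w + c (n + 1)) - p ^ (k + 1) • z := by
    rw [← hw, hz, add_sub_cancel_left]
  rw [hcn, nsmul_add, nsmul_sub, pow_succ, mul_nsmul', smul_comm p (p ^ k) w]
  abel

theorem IsCompatible.sum_eq_aug {p : ℕ} {f : ∀ n : ℕ, ZMod (p ^ n) →₀ M}
    (hf : IsCompatible p M f) (n : ℕ) : ((f n).sum fun _ a => a) = aug p M f := by
  induction n with
  | zero => rfl
  | succ n ih => rw [← ih, ← hf n, sum_mapDomain]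

theorem IsCompatible.sub {p : ℕ} {f g : ∀ n : ℕ, ZMod (p ^ n) →₀ M}
    (hf : IsCompatible p M f) (hg : IsCompatible p M g) :
    IsCompatible p M fun n => f n - g n := by
  intro n
  change _ = f n - g n
  rw [← hf n, ← hg n]
  exact map_sub (Finsupp.mapDomain.addMonoidHom
    (ZMod.castHom (pow_dvd_pow p n.le_succ) (ZMod (p ^ n)))) _ _

theorem mapDomain_normElement_pow_succ (p n : ℕ) (c : M) :
    Finsupp.mapDomain (ZMod.castHom (pow_dvd_pow p n.le_succ) (ZMod (p ^ n)))
      (normElement (p ^ (n + 1)) c) = normElement (p ^ n) (p • c) :=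
  mapDomain_normElement (p ^ n) p (pow_dvd_pow p n.le_succ) c

theorem IsCompatible.eq_zero_of_levelShift_eq_zero {p : ℕ} [NeZero p]
    [IsHausdorff (Ideal.span {(p : ℤ)}) M] {f : ∀ n : ℕ, ZMod (p ^ n) →₀ M}
    (hf : IsCompatible p M f) (h : ∀ n, levelShift (p ^ n) (f n) = 0) (n : ℕ) : f n = 0 := by
  have hconst (n : ℕ) := eq_normElement_of_levelShift_eq_zero (p ^ n) (h n)
  have hc (n : ℕ) : f n 0 = p • f (n + 1) 0 := by
    rw [← hf n, hconst (n + 1), mapDomain_normElement_pow_succ, normElement_apply,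
      normElement_apply]
  rw [hconst n, eq_zero_of_forall_eq_nsmul_succ hc n, normElement_zero]

theorem IsCompatible.exists_shift_eq {p : ℕ} [NeZero p]
    [IsAdicComplete (Ideal.span {(p : ℤ)}) M] {f : ∀ n : ℕ, ZMod (p ^ n) →₀ M}
    (hf : IsCompatible p M f) (h : aug p M f = 0) :
    ∃ e : ∀ n : ℕ, ZMod (p ^ n) →₀ M, IsCompatible p M e ∧ shift p M e = f := by
  have hlevel (n : ℕ) : ∃ e, levelShift (p ^ n) e = f n := by
    simpa [hf.sum_eq_aug n, h] using sub_single_sum_mem_range_levelShift (p ^ n) (f n)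
  choose e he using hlevel
  have hdefect (n : ℕ) : ∃ d, Finsupp.mapDomain
      (ZMod.castHom (pow_dvd_pow p n.le_succ) (ZMod (p ^ n))) (e (n + 1)) =
        e n + normElement (p ^ n) d := by
    refine ⟨_, sub_eq_iff_eq_add'.1 (eq_normElement_of_levelShift_eq_zero (p ^ n) ?_)⟩
    rw [map_sub, ← mapDomain_castHom_levelShift, he, he, hf n, sub_self]
  choose d hd using hdefect
  obtain ⟨c, hc⟩ := exists_eq_add_nsmul_succ (p := p) d
  refine ⟨fun n => e n + normElement (p ^ n) (c n), fun n => ?_, funext fun n => ?_⟩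
  · rw [Finsupp.mapDomain_add, hd, mapDomain_normElement_pow_succ, add_assoc,
      ← normElement_add, ← hc]
  · change levelShift (p ^ n) (e n + normElement (p ^ n) (c n)) = f n
    rw [map_add, he, levelShift_normElement, add_zero]

end Helpers

/-- Let `p` be a prime and `A` an abelian group that is `p`-adically complete
and Hausdorff (the canonical map `A → lim_n A/pⁿA` is an isomorphism; formalized as
`IsAdicComplete (span {p}) A` over `ℤ`).  Then the sequence
`0 → A[[ℤ_p]] → A[[ℤ_p]] → A → 0`, with first map `T` the limit of `f ↦ (g ↦ f(g−1) − f(g))`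
and second map the augmentation `ε`, is exact: `T` is injective, `ε` is surjective, and the
kernel of `ε` is exactly the image of `T`. -/
theorem shift_aug_exact (hp : p.Prime)
    (hA : IsAdicComplete (Ideal.span {(p : ℤ)}) A) :
    (∀ f g : ∀ n : ℕ, ZMod (p ^ n) →₀ A, IsCompatible p A f → IsCompatible p A g →
        shift p A f = shift p A g → f = g) ∧
    (∀ a : A, ∃ f : ∀ n : ℕ, ZMod (p ^ n) →₀ A, IsCompatible p A f ∧ aug p A f = a) ∧
    (∀ f : ∀ n : ℕ, ZMod (p ^ n) →₀ A, IsCompatible p A f →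
        (aug p A f = 0 ↔ ∃ e : ∀ n : ℕ, ZMod (p ^ n) →₀ A,
          IsCompatible p A e ∧ shift p A e = f)) := by
  have : NeZero p := ⟨hp.ne_zero⟩
  refine ⟨fun f g hf hg h => funext fun n => sub_eq_zero.1 ?_, fun a => ?_, fun f hf =>
    ⟨hf.exists_shift_eq, ?_⟩⟩
  · refine (hf.sub hg).eq_zero_of_levelShift_eq_zero (fun k => ?_) n
    rw [map_sub, sub_eq_zero]
    exact congrFun h k
  · exact ⟨fun n => Finsupp.single 0 a, fun n => by simp [Finsupp.mapDomain_single],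
      Finsupp.sum_single_index rfl⟩
  · rintro ⟨e, -, rfl⟩
    rw [aug, shift, Finsupp.sum_sub_index fun _ _ _ => rfl, sum_mapDomain, sub_self]

end CompletedGroupRing
end
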